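/- The set of 4×4 real matrices M such that (i) M is a product of four balanced beam-splitter matrices, i.e., M = B(j₃,k₃)·B(j₂,k₂)·B(j₁,k₁)·B(j₀,k₀) for some ordered pairs (jᵢ,kᵢ) of distinct indices in {1,2,3,4}, and (ii) every entry of M has absolute value 1/2, has exactly 40 elements. In particular, networks of four balanced beam splitters realize only 40 of the 768 balanced four-splitter matrices. -/

import Mathlib

open Matrix

/-- The 4×4 real balanced beam-splitter matrix `B(j,k)`: it agrees with the
identity except in rows and columns `j` and `k`, where
`B jj = B kk = 1/√2`, `B jk = −1/√2`, `B kj = 1/√2`. -/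
noncomputable def Bsplit (j k : Fin 4) : Matrix (Fin 4) (Fin 4) ℝ :=
  fun a b =>
    if a = j then (if b = j then 1 / Real.sqrt 2 else if b = k then -(1 / Real.sqrt 2) else 0)
    else if a = k then (if b = j then 1 / Real.sqrt 2 else if b = k then 1 / Real.sqrt 2 else 0)
    else if b = a then 1 else 0

/-- The integer matrix agreeing with `√2 • Bsplit j k` in rows `j` and `k`, and zero elsewhere. -/
def splitBlock (j k : Fin 4) : Matrix (Fin 4) (Fin 4) ℤ :=
  fun a b =>
    if a = j then (if b = j then 1 else if b = k then -1 else 0)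
    else if a = k then (if b = j then 1 else if b = k then 1 else 0)
    else 0

/-- The index pairs `(j, k)` and `(j', k')` partition `Fin 4`. -/
abbrev IsPairing (j k j' k' : Fin 4) : Prop :=
  [j, k, j', k'].Nodup

/-- The integer matrices `√2 • (Bsplit j k * Bsplit j' k')` of layers of two beam splitters
acting on disjoint pairs of indices. -/
def layers : Finset (Matrix (Fin 4) (Fin 4) ℤ) :=
  ({p | IsPairing p.1.1 p.1.2 p.2.1 p.2.2} : Finset ((Fin 4 × Fin 4) × (Fin 4 × Fin 4))).image
    fun p => splitBlock p.1.1 p.1.2 + splitBlock p.2.1 p.2.2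

/-- The sign matrices that are products of two layers. -/
def signLayerProducts : Finset (Matrix (Fin 4) (Fin 4) ℤ) :=
  ((layers ×ˢ layers).image fun p => p.1 * p.2).filter fun A => ∀ a b, |A a b| = 1

theorem card_signLayerProducts : signLayerProducts.card = 40 := by
  decide +kernel

theorem mem_layers {A : Matrix (Fin 4) (Fin 4) ℤ} :
    A ∈ layers ↔ ∃ j k j' k', IsPairing j k j' k' ∧ splitBlock j k + splitBlock j' k' = A := by
  simp only [layers, Finset.mem_image, Finset.mem_filter, Finset.mem_univ, true_and, Prod.exists]

theorem Bsplit_mul_apply {j k : Fin 4} (h : j ≠ k) (N : Matrix (Fin 4) (Fin 4) ℝ) (a b : Fin 4) :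
    (Bsplit j k * N) a b =
      if a = j then 1 / √2 * (N j b - N k b)
      else if a = k then 1 / √2 * (N j b + N k b) else N a b := by
  have hk := h.symm
  simp only [Matrix.mul_apply, Bsplit]
  split_ifs with h1 h2
  · simp only [ite_mul, zero_mul]
    rw [Finset.sum_eq_add j k h (by intro c _ hc; simp [hc.1, hc.2]) (by simp) (by simp)]
    simp [hk]; ring
  · simp only [ite_mul, zero_mul]
    rw [Finset.sum_eq_add j k h (by intro c _ hc; simp [hc.1, hc.2]) (by simp) (by simp)]
    simp [hk]; ring
  · simp

theorem Bsplit_mul_Bsplit_of_isPairing {j k j' k' : Fin 4} (h : IsPairing j k j' k') :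
    Bsplit j k * Bsplit j' k' =
      (1 / √2) • (splitBlock j k + splitBlock j' k').map (Int.cast : ℤ → ℝ) := by
  have h' := h
  simp only [IsPairing, List.nodup_cons, List.mem_cons, List.not_mem_nil, not_or] at h
  obtain ⟨⟨hjk, hjj', hjk', -⟩, ⟨hkj', hkk', -⟩, ⟨hjk2, -⟩, -⟩ := h
  have hcov : ∀ a, a = j ∨ a = k ∨ a = j' ∨ a = k' := by
    clear hjk hjj' hjk' hkj' hkk' hjk2
    revert j k j' k'
    decide
  ext a b
  rw [Bsplit_mul_apply hjk]
  simp only [Matrix.smul_apply, Matrix.map_apply, Matrix.add_apply, smul_eq_mul, Bsplit,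
    splitBlock]
  rcases hcov a with rfl | rfl | rfl | rfl <;>
    simp [*, Ne.symm, eq_comm] <;> split_ifs <;> simp_all

theorem mul_Bsplit_apply_of_ne {j k b : Fin 4} (hj : b ≠ j) (hk : b ≠ k)
    (N : Matrix (Fin 4) (Fin 4) ℝ) (a : Fin 4) : (N * Bsplit j k) a b = N a b := by
  simp only [Matrix.mul_apply, Bsplit, hj, hk, if_false]
  rw [Finset.sum_eq_single b] <;> simp +contextual [hj, hk, eq_comm]

theorem eq_or_mem_of_Bsplit_apply_ne_zero {j k a b : Fin 4} (h : Bsplit j k a b ≠ 0) :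
    a = b ∨ (a = j ∨ a = k) ∧ (b = j ∨ b = k) := by
  unfold Bsplit at h
  split_ifs at h <;> simp_all

theorem exists_Bsplit_mul_apply_col_eq_zero (j k j' k' d : Fin 4) :
    ∃ a, (Bsplit j k * Bsplit j' k') a d = 0 := by
  have key : ∀ j k j' k' d : Fin 4, ∃ a, ∀ c,
      ¬((a = c ∨ (a = j ∨ a = k) ∧ (c = j ∨ c = k)) ∧
        (c = d ∨ (c = j' ∨ c = k') ∧ (d = j' ∨ d = k'))) := by decide +kernel
  obtain ⟨a, ha⟩ := key j k j' k' d
  refine ⟨a, (Matrix.mul_apply).trans (Finset.sum_eq_zero fun c _ => ?_)⟩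
  by_contra hc
  exact ha c ⟨eq_or_mem_of_Bsplit_apply_ne_zero (left_ne_zero_of_mul hc),
    eq_or_mem_of_Bsplit_apply_ne_zero (right_ne_zero_of_mul hc)⟩

theorem exists_Bsplit_mul_apply_row_eq_zero (j k j' k' d : Fin 4) :
    ∃ b, (Bsplit j k * Bsplit j' k') d b = 0 := by
  have key : ∀ j k j' k' d : Fin 4, ∃ b, ∀ c,
      ¬((d = c ∨ (d = j ∨ d = k) ∧ (c = j ∨ c = k)) ∧
        (c = b ∨ (c = j' ∨ c = k') ∧ (b = j' ∨ b = k'))) := by decide +kernel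
  obtain ⟨b, hb⟩ := key j k j' k' d
  refine ⟨b, (Matrix.mul_apply).trans (Finset.sum_eq_zero fun c _ => ?_)⟩
  by_contra hc
  exact hb c ⟨eq_or_mem_of_Bsplit_apply_ne_zero (left_ne_zero_of_mul hc),
    eq_or_mem_of_Bsplit_apply_ne_zero (right_ne_zero_of_mul hc)⟩

theorem exists_ne_of_not_isPairing :
    ∀ {j k j' k' : Fin 4}, ¬IsPairing j k j' k' → ∃ d, d ≠ j ∧ d ≠ k ∧ d ≠ j' ∧ d ≠ k' := by
  decide +kernel

/-- If no entry of a product of four beam splitters vanishes, then the first two and the last two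
of them act on disjoint pairs of indices. -/
theorem isPairing_of_forall_ne_zero {j k : Fin 4 → Fin 4} (hjk : ∀ i, j i ≠ k i)
    (h : ∀ a b, (Bsplit (j 3) (k 3) * Bsplit (j 2) (k 2) *
      Bsplit (j 1) (k 1) * Bsplit (j 0) (k 0)) a b ≠ 0) :
    IsPairing (j 3) (k 3) (j 2) (k 2) ∧ IsPairing (j 1) (k 1) (j 0) (k 0) := by
  constructor <;> by_contra hp <;> obtain ⟨d, h1, h2, h3, h4⟩ := exists_ne_of_not_isPairing hp
  · obtain ⟨b, hb⟩ := exists_Bsplit_mul_apply_row_eq_zero (j 1) (k 1) (j 0) (k 0) d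
    apply h d b
    rw [Matrix.mul_assoc, Matrix.mul_assoc, Bsplit_mul_apply (hjk 3), if_neg h1, if_neg h2,
      Bsplit_mul_apply (hjk 2), if_neg h3, if_neg h4, hb]
  · obtain ⟨a, ha⟩ := exists_Bsplit_mul_apply_col_eq_zero (j 3) (k 3) (j 2) (k 2) d
    apply h a d
    rw [mul_Bsplit_apply_of_ne h3 h4, mul_Bsplit_apply_of_ne h1 h2, ha]

theorem Bsplit_mul_four_of_isPairing {j k : Fin 4 → Fin 4}
    (h : IsPairing (j 3) (k 3) (j 2) (k 2)) (h' : IsPairing (j 1) (k 1) (j 0) (k 0)) :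
    Bsplit (j 3) (k 3) * Bsplit (j 2) (k 2) * Bsplit (j 1) (k 1) * Bsplit (j 0) (k 0) =
      (1 / 2 : ℝ) • ((splitBlock (j 3) (k 3) + splitBlock (j 2) (k 2)) *
        (splitBlock (j 1) (k 1) + splitBlock (j 0) (k 0))).map (Int.cast : ℤ → ℝ) := by
  rw [Matrix.mul_assoc _ (Bsplit (j 1) (k 1)), Bsplit_mul_Bsplit_of_isPairing h,
    Bsplit_mul_Bsplit_of_isPairing h', Matrix.smul_mul, Matrix.mul_smul, smul_smul,
    ← Matrix.map_mul_intCast]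
  congr 1
  rw [div_mul_div_comm, Real.mul_self_sqrt zero_le_two, one_mul]

theorem abs_half_smul_map_apply_eq_half_iff (A : Matrix (Fin 4) (Fin 4) ℤ) (a b : Fin 4) :
    |((1 / 2 : ℝ) • A.map (Int.cast : ℤ → ℝ)) a b| = 1 / 2 ↔ |A a b| = 1 := by
  rw [Matrix.smul_apply, Matrix.map_apply, smul_eq_mul, abs_mul, abs_of_pos one_half_pos,
    mul_eq_left₀ one_half_pos.ne']
  exact_mod_cast Iff.rfl

theorem half_smul_map_injective :
    Function.Injective fun A : Matrix (Fin 4) (Fin 4) ℤ =>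
      (1 / 2 : ℝ) • A.map (Int.cast : ℤ → ℝ) :=
  (smul_right_injective _ one_half_pos.ne').comp (Matrix.map_injective Int.cast_injective)

theorem mem_signLayerProducts {A : Matrix (Fin 4) (Fin 4) ℤ} :
    A ∈ signLayerProducts ↔ (∃ P ∈ layers, ∃ Q ∈ layers, P * Q = A) ∧ ∀ a b, |A a b| = 1 := by
  simp [signLayerProducts, and_assoc]

/-- Networks of four balanced beam splitters realize exactly 40 balanced
four-splitter matrices. -/
theorem card_four_splitters_from_beam_splitter_networks :
    {M : Matrix (Fin 4) (Fin 4) ℝ |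
      (∃ j k : Fin 4 → Fin 4, (∀ i, j i ≠ k i) ∧
        M = Bsplit (j 3) (k 3) * Bsplit (j 2) (k 2) *
          Bsplit (j 1) (k 1) * Bsplit (j 0) (k 0)) ∧
      ∀ a b, |M a b| = 1 / 2}.ncard = 40 := by
  rw [← card_signLayerProducts, ← Set.ncard_coe_finset,
    ← Set.ncard_image_of_injective _ half_smul_map_injective]
  congr 1
  ext M
  simp only [Set.mem_ofPred_eq, Set.mem_image, SetLike.mem_coe, mem_signLayerProducts, mem_layers]
  constructor
  · rintro ⟨⟨j, k, hjk, rfl⟩, hM⟩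
    obtain ⟨h, h'⟩ := isPairing_of_forall_ne_zero hjk fun a b h0 => by
      have := hM a b
      rw [h0] at this
      norm_num at this
    rw [Bsplit_mul_four_of_isPairing h h'] at hM ⊢
    exact ⟨_, ⟨⟨_, ⟨_, _, _, _, h, rfl⟩, _, ⟨_, _, _, _, h', rfl⟩, rfl⟩,
      fun a b => (abs_half_smul_map_apply_eq_half_iff _ a b).1 (hM a b)⟩, rfl⟩
  · rintro ⟨_, ⟨⟨_, ⟨j₃, k₃, j₂, k₂, h, rfl⟩, _, ⟨j₁, k₁, j₀, k₀, h', rfl⟩, rfl⟩, hA⟩, rfl⟩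
    refine ⟨⟨![j₀, j₁, j₂, j₃], ![k₀, k₁, k₂, k₃], ?_, ?_⟩,
      fun a b => (abs_half_smul_map_apply_eq_half_iff _ a b).2 (hA a b)⟩
    · simp only [IsPairing, List.nodup_cons, List.mem_cons, not_or] at h h'
      intro i
      fin_cases i
      exacts [h'.2.2.1.1, h'.1.1, h.2.2.1.1, h.1.1]
    · exact (Bsplit_mul_four_of_isPairing (j := ![j₀, j₁, j₂, j₃]) (k := ![k₀, k₁, k₂, k₃])
        h h').symm
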